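/- arXiv:2502.12042 — 9 statements merged into one kernel-verified Lean document; each statement's English description precedes it below -/
import Mathlib

section
/- Every covering agreement is Pareto-optimal: if a : C → M is covering, then there is no agreement a' : C → M whose cost is ≤ that of a for every player and strictly < for some player. -/
/-- The load of resource `x` under agreement `a`: the number of players choosing `x`. -/
def load {C M : Type*} [Fintype C] [DecidableEq M] (a : C → M) (x : M) : ℕ :=
  (Finset.univ.filter fun i => a i = x).card

/-- An agreement is covering if it uses as many resources as possible. -/
def Covering {C M : Type*} [Fintype C] [Fintype M] [DecidableEq M] (a : C → M) : Prop :=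
  (Fintype.card M ≤ Fintype.card C → ∀ x : M, 1 ≤ load a x) ∧
  (Fintype.card C < Fintype.card M → ∀ x : M, load a x ≤ 1)

/-- The chosen resource of a player has positive load. -/
theorem load_apply_pos {C M : Type*} [Fintype C] [DecidableEq M] (a : C → M) (i : C) :
    0 < load a (a i) :=
  Finset.card_pos.mpr ⟨i, by simp⟩

/-- The reciprocals of the players' loads add up to the number of used resources. -/
theorem sum_inv_load {C M : Type*} [Fintype C] [DecidableEq M] (a : C → M) :
    ∑ i, (load a (a i) : ℚ)⁻¹ = (Finset.univ.image a).card := by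
  rw [Finset.sum_comp (fun x => (load a x : ℚ)⁻¹) a, Finset.cast_card]
  refine Finset.sum_congr rfl fun x hx => ?_
  obtain ⟨i, -, rfl⟩ := Finset.mem_image.mp hx
  have h : (load a (a i) : ℚ) ≠ 0 := by exact_mod_cast (load_apply_pos a i).ne'
  rw [nsmul_eq_mul]
  exact mul_inv_cancel₀ h

/-- Every covering agreement is Pareto-optimal. -/
theorem covering_imp_paretoOptimal
    {C M : Type*} [Fintype C] [Fintype M] [DecidableEq M] [Nonempty C] [Nonempty M]
    (f : ℕ → ℚ)
    (hf_mono : ∀ k, f k < f (k + 1))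
    (hf_conv : ∀ k, f (k + 1) - f k ≤ f (k + 2) - f (k + 1))
    (a : C → M) (hcov : Covering a) :
    ¬ ∃ a' : C → M,
        (∀ i : C, f (load a' (a' i)) ≤ f (load a (a i))) ∧
        (∃ j : C, f (load a' (a' j)) < f (load a (a j))) := by
  rintro ⟨a', hle, j, hlt⟩
  have hf : StrictMono f := strictMono_nat_of_lt_succ hf_mono
  replace hle i : load a' (a' i) ≤ load a (a i) := hf.le_iff_le.mp (hle i)
  replace hlt : load a' (a' j) < load a (a j) := hf.lt_iff_lt.mp hlt
  rcases le_or_gt (Fintype.card M) (Fintype.card C) with h | h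
  · have hpos i : (0 : ℚ) < load a' (a' i) := by exact_mod_cast load_apply_pos a' i
    have hsum : ∑ i, (load a (a i) : ℚ)⁻¹ < ∑ i, (load a' (a' i) : ℚ)⁻¹ :=
      Finset.sum_lt_sum
        (fun i _ => inv_anti₀ (hpos i) (by exact_mod_cast hle i))
        ⟨j, Finset.mem_univ j, inv_strictAnti₀ (hpos j) (by exact_mod_cast hlt)⟩
    rw [sum_inv_load, sum_inv_load, Nat.cast_lt] at hsum
    have himage : Finset.univ.image a = Finset.univ := by
      refine Finset.eq_univ_of_forall fun x => ?_
      obtain ⟨i, hi⟩ := Finset.card_pos.mp (hcov.1 h x)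
      exact Finset.mem_image.mpr ⟨i, Finset.mem_univ i, (Finset.mem_filter.mp hi).2⟩
    rw [himage] at hsum
    exact absurd hsum (Finset.card_le_univ _).not_gt
  · have := hcov.2 h (a j)
    have := load_apply_pos a' j
    lia
end

section
/- Every Pareto-optimal agreement is covering: if a : C → M is not covering, then there exists an agreement a' : C → M whose cost is ≤ that of a for every player and strictly < for some player. -/
theorem not_injective_and_not_surjective_of_not_covering {C M : Type*} [Fintype C] [Fintype M]
    [DecidableEq M] {a : C → M} (h : ¬ Covering a) :
    ¬ Function.Injective a ∧ ¬ Function.Surjective a := by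
  rw [Covering, not_and_or] at h
  rcases h with h | h
  · push Not at h
    obtain ⟨hcard, z, hz⟩ := h
    have hsurj : ¬ Function.Surjective a := by
      intro hs
      obtain ⟨i, hi⟩ := hs z
      have : 0 < load a z := Finset.card_pos.2 ⟨i, by simp [hi]⟩
      omega
    refine ⟨fun hi => hsurj ?_, hsurj⟩
    exact ((Fintype.bijective_iff_injective_and_card a).2
      ⟨hi, (Fintype.card_le_of_injective a hi).antisymm hcard⟩).2
  · push Not at h
    obtain ⟨hcard, y, hy⟩ := h
    refine ⟨fun hi => ?_, fun hs => (Fintype.card_le_of_surjective a hs).not_gt hcard⟩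
    obtain ⟨i, hi', k, hk, hik⟩ := Finset.one_lt_card.1 hy
    simp only [Finset.mem_filter, Finset.mem_univ, true_and] at hi' hk
    exact hik (hi (hi'.trans hk.symm))

theorem load_update_self_of_unused {C M : Type*} [Fintype C] [DecidableEq C] [DecidableEq M]
    {a : C → M} {z : M} (hz : ∀ i, a i ≠ z) (j : C) :
    load (Function.update a j z) z = 1 := by
  refine Finset.card_eq_one.2 ⟨j, ?_⟩
  ext i
  by_cases hij : i = j <;> simp [Function.update_apply, hij, hz]

theorem load_update_le {C M : Type*} [Fintype C] [DecidableEq C] [DecidableEq M]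
    (a : C → M) (j : C) {x z : M} (hx : x ≠ z) :
    load (Function.update a j z) x ≤ load a x := by
  refine Finset.card_le_card fun i => ?_
  by_cases hij : i = j <;> simp [Function.update_apply, hij, hx.symm]

/-- Every Pareto-optimal agreement is covering: a non-covering agreement
admits a Pareto-improvement. -/
theorem paretoOptimal_imp_covering
    {C M : Type*} [Fintype C] [Fintype M] [DecidableEq M] [Nonempty C] [Nonempty M]
    (f : ℕ → ℚ)
    (hf_mono : ∀ k, f k < f (k + 1))
    (hf_conv : ∀ k, f (k + 1) - f k ≤ f (k + 2) - f (k + 1))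
    (a : C → M) (hncov : ¬ Covering a) :
    ∃ a' : C → M,
      (∀ i : C, f (load a' (a' i)) ≤ f (load a (a i))) ∧
      (∃ j : C, f (load a' (a' j)) < f (load a (a j))) := by
  classical
  obtain ⟨hinj, hsurj⟩ := not_injective_and_not_surjective_of_not_covering hncov
  simp only [Function.Injective, Function.Surjective, not_forall, not_exists] at hinj hsurj
  obtain ⟨j, k, hjk, hne⟩ := hinj
  obtain ⟨z, hz⟩ := hsurj
  have hf : StrictMono f := strictMono_nat_of_lt_succ hf_mono
  have hj : f (load (Function.update a j z) (Function.update a j z j)) < f (load a (a j)) := by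
    rw [Function.update_self, load_update_self_of_unused hz]
    exact hf (Finset.one_lt_card.2 ⟨j, by simp, k, by simp [hjk], hne⟩)
  refine ⟨Function.update a j z, fun i => ?_, j, hj⟩
  by_cases hij : i = j
  · exact hij ▸ hj.le
  · rw [Function.update_of_ne hij]
    exact hf.monotone (load_update_le a j (hz i))
end

section
/- Every covering agreement that is envy-free is credible: if a : C → M is covering and all players incur the same cost under a, then for every player i ∈ C and every resource x ∈ M, f(n_{a(i)}(a)) ≤ f(n_x(a) + 1). -/
/-- Every covering agreement that is envy-free is credible. -/
theorem covering_envyFree_imp_credible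
    {C M : Type*} [Fintype C] [Fintype M] [DecidableEq M] [Nonempty C] [Nonempty M]
    (f : ℕ → ℚ)
    (hf_mono : ∀ k, f k < f (k + 1))
    (hf_conv : ∀ k, f (k + 1) - f k ≤ f (k + 2) - f (k + 1))
    (a : C → M) (hcov : Covering a)
    (henvy : ∀ i j : C, f (load a (a i)) = f (load a (a j))) :
    ∀ (i : C) (x : M), f (load a (a i)) ≤ f (load a x + 1) := by
  intro i x
  have hmono : StrictMono f := strictMono_nat_of_lt_succ hf_mono
  refine hmono.monotone ?_
  rcases le_or_gt (Fintype.card M) (Fintype.card C) with h | h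
  · have hx := hcov.1 h x
    obtain ⟨j, hj⟩ := Finset.card_pos.mp hx
    obtain rfl : a j = x := (Finset.mem_filter.mp hj).2
    exact (hmono.injective (henvy i j)).le.trans (Nat.le_succ _)
  · exact (hcov.2 h (a i)).trans (Nat.le_add_left 1 _)
end

section
/- Every credible agreement is covering: if a : C → M satisfies f(n_{a(i)}(a)) ≤ f(n_x(a) + 1) for every player i ∈ C and every resource x ∈ M, then a is covering. -/
theorem load_eq_zero_iff {C M : Type*} [Fintype C] [DecidableEq M] (a : C → M) (x : M) :
    load a x = 0 ↔ ∀ i, a i ≠ x := by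
  simp [load, Finset.filter_eq_empty_iff]

theorem load_le_one_iff_injective {C M : Type*} [Fintype C] [DecidableEq M] (a : C → M) :
    (∀ x, load a x ≤ 1) ↔ Function.Injective a := by
  simp only [load, Finset.card_le_one, Finset.mem_filter, Finset.mem_univ, true_and]
  exact ⟨fun h i j hij => h (a j) i hij j rfl, fun h _ i hi j hj => h (hi.trans hj.symm)⟩

/-- In a credible agreement, an unused resource forces all loads to be at most one. -/
theorem load_le_one_of_load_eq_zero {C M : Type*} [Fintype C] [DecidableEq M]
    {f : ℕ → ℚ} (hf : StrictMono f) {a : C → M}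
    (hcred : ∀ (i : C) (x : M), f (load a (a i)) ≤ f (load a x + 1))
    {x : M} (hx : load a x = 0) (y : M) : load a y ≤ 1 := by
  by_cases hy : load a y = 0
  · omega
  · rw [load_eq_zero_iff] at hy
    push Not at hy
    obtain ⟨i, rfl⟩ := hy
    simpa [hx] using hf.le_iff_le.mp (hcred i x)

/-- Every credible agreement is covering. -/
theorem credible_imp_covering
    {C M : Type*} [Fintype C] [Fintype M] [DecidableEq M] [Nonempty C] [Nonempty M]
    (f : ℕ → ℚ)
    (hf_mono : ∀ k, f k < f (k + 1))
    (hf_conv : ∀ k, f (k + 1) - f k ≤ f (k + 2) - f (k + 1))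
    (a : C → M)
    (hcred : ∀ (i : C) (x : M), f (load a (a i)) ≤ f (load a x + 1)) :
    Covering a := by
  have hf : StrictMono f := strictMono_nat_of_lt_succ hf_mono
  refine ⟨fun hcard x => ?_, fun hcard => ?_⟩
  · by_contra hx
    have hx : load a x = 0 := by omega
    have hinj := (load_le_one_iff_injective a).mp (load_le_one_of_load_eq_zero hf hcred hx)
    obtain ⟨i, hi⟩ := (hinj.bijective_of_nat_card_le (by simpa using hcard)).surjective x
    exact (load_eq_zero_iff a x).mp hx i hi
  · have hsurj : ¬ Function.Surjective a := fun h =>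
      (Fintype.card_le_of_surjective a h).not_gt hcard
    simp only [Function.Surjective, not_forall, not_exists] at hsurj
    obtain ⟨x, hx⟩ := hsurj
    exact load_le_one_of_load_eq_zero hf hcred ((load_eq_zero_iff a x).mpr hx)
end

section
/- Rebalancing an overloaded resource strictly decreases total cost: if f : ℕ → ℚ is strictly increasing and convex, and p, q ∈ ℕ satisfy p ≥ q + 2, then (p−1)·f(p−1) + (q+1)·f(q+1) < p·f(p) + q·f(q). -/
/-- The marginal total cost of a resource is strictly increasing in its load. -/
theorem strictMono_marginalCost {f : ℕ → ℚ}
    (hf_mono : ∀ k, f k < f (k + 1))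
    (hf_conv : ∀ k, f (k + 1) - f k ≤ f (k + 2) - f (k + 1)) :
    StrictMono fun k : ℕ => ((k : ℚ) + 1) * f (k + 1) - k * f k := by
  refine strictMono_nat_of_lt_succ fun k => ?_
  have h_conv : 0 ≤ (k : ℚ) * ((f (k + 2) - f (k + 1)) - (f (k + 1) - f k)) :=
    mul_nonneg k.cast_nonneg (sub_nonneg.2 (hf_conv k))
  have h_mono : f (k + 1) < f (k + 2) := hf_mono (k + 1)
  push_cast
  linarith

/-- Moving one player from a resource with load `p` to a resource with
load `q`, where `p ≥ q + 2`, strictly decreases total cost. -/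
theorem rebalance_decreases_totalCost
    (f : ℕ → ℚ)
    (hf_mono : ∀ k, f k < f (k + 1))
    (hf_conv : ∀ k, f (k + 1) - f k ≤ f (k + 2) - f (k + 1))
    (p q : ℕ) (hpq : q + 2 ≤ p) :
    ((p : ℚ) - 1) * f (p - 1) + ((q : ℚ) + 1) * f (q + 1) < (p : ℚ) * f p + (q : ℚ) * f q := by
  obtain ⟨n, rfl⟩ : ∃ n, p = n + 1 := ⟨p - 1, by omega⟩
  have h := strictMono_marginalCost hf_mono hf_conv (show q < n by omega)
  simp only [Nat.add_sub_cancel]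
  push_cast
  linarith
end

section
/- Suppose m divides |C| and the agreement a : C → M has load n_x(a) = |C|/m for every resource x ∈ M. Then a is envy-free, credible, and Pareto-optimal. -/
/-- The loads of all resources add up to the number of players. -/
theorem sum_load {C M : Type*} [Fintype C] [Fintype M] [DecidableEq M] (a : C → M) :
    ∑ x, load a x = Fintype.card C :=
  (Finset.card_eq_sum_card_fiberwise fun i _ => Finset.mem_univ (a i)).symm

/-- If `m ∣ |C|` and every resource is chosen by exactly `|C|/m` players,
then the agreement is envy-free, credible, and Pareto-optimal. -/
theorem uniform_load_imp_envyFree_credible_pareto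
    {C M : Type*} [Fintype C] [Fintype M] [DecidableEq M] [Nonempty C] [Nonempty M]
    (f : ℕ → ℚ)
    (hf_mono : ∀ k, f k < f (k + 1))
    (hf_conv : ∀ k, f (k + 1) - f k ≤ f (k + 2) - f (k + 1))
    (hdvd : Fintype.card M ∣ Fintype.card C)
    (a : C → M)
    (hload : ∀ x : M, load a x = Fintype.card C / Fintype.card M) :
    (∀ i j : C, f (load a (a i)) = f (load a (a j))) ∧
    (∀ (i : C) (x : M), f (load a (a i)) ≤ f (load a x + 1)) ∧
    (¬ ∃ a' : C → M,
        (∀ i : C, f (load a' (a' i)) ≤ f (load a (a i))) ∧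
        (∃ j : C, f (load a' (a' j)) < f (load a (a j)))) := by
  have hf : StrictMono f := strictMono_nat_of_lt_succ hf_mono
  refine ⟨fun i j => by rw [hload, hload], fun i x => ?_, ?_⟩
  · rw [hload, hload]
    exact (hf_mono _).le
  · rintro ⟨a', hle, j, hj⟩
    simp only [hload, hf.le_iff_le] at hle
    simp only [hload, hf.lt_iff_lt] at hj
    have hle' : ∀ x, load a' x ≤ Fintype.card C / Fintype.card M := by
      intro x
      by_cases hx : ∃ i, a' i = x
      · obtain ⟨i, rfl⟩ := hx
        exact hle i
      · push Not at hx
        simp [load, hx]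
    have hlt : ∑ x, load a' x < ∑ _x : M, Fintype.card C / Fintype.card M :=
      Finset.sum_lt_sum (fun x _ => hle' x) ⟨a' j, Finset.mem_univ _, hj⟩
    rw [sum_load, Finset.sum_const, Finset.card_univ, smul_eq_mul, Nat.mul_div_cancel' hdvd] at hlt
    exact lt_irrefl _ hlt
end

section
/- Suppose |C| < m and the agreement a : C → M is envy-free, credible, and Pareto-optimal. Then a is injective (no resource is chosen by more than one player). -/
theorem load_pos {C M : Type*} [Fintype C] [DecidableEq M] (a : C → M) (i : C) :
    1 ≤ load a (a i) :=
  Finset.card_pos.mpr ⟨i, by simp⟩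

theorem load_eq_one_of_injective {C M : Type*} [Fintype C] [DecidableEq M] {a : C → M}
    (ha : Function.Injective a) (i : C) : load a (a i) = 1 :=
  Finset.card_eq_one.mpr ⟨i, by ext j; simp [ha.eq_iff]⟩

theorem one_lt_load_of_eq {C M : Type*} [Fintype C] [DecidableEq M] {a : C → M} {i j : C}
    (h : a i = a j) (hij : i ≠ j) : 1 < load a (a i) :=
  Finset.one_lt_card.mpr ⟨i, by simp, j, by simp [h], hij⟩

/-- If `|C| < m` and the agreement is envy-free, credible, and
Pareto-optimal, then it is injective. -/
theorem envyFree_credible_pareto_imp_injective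
    {C M : Type*} [Fintype C] [Fintype M] [DecidableEq M] [Nonempty C] [Nonempty M]
    (f : ℕ → ℚ)
    (hf_mono : ∀ k, f k < f (k + 1))
    (hf_conv : ∀ k, f (k + 1) - f k ≤ f (k + 2) - f (k + 1))
    (hcard : Fintype.card C < Fintype.card M)
    (a : C → M)
    (henvy : ∀ i j : C, f (load a (a i)) = f (load a (a j)))
    (hcred : ∀ (i : C) (x : M), f (load a (a i)) ≤ f (load a x + 1))
    (hpareto : ¬ ∃ a' : C → M,
        (∀ i : C, f (load a' (a' i)) ≤ f (load a (a i))) ∧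
        (∃ j : C, f (load a' (a' j)) < f (load a (a j)))) :
    Function.Injective a := by
  intro i j hij
  by_contra hne
  obtain ⟨e⟩ := Function.Embedding.nonempty_of_card_le hcard.le
  have hf : StrictMono f := strictMono_nat_of_lt_succ hf_mono
  refine hpareto ⟨e, fun k => ?_, i, ?_⟩
  · rw [load_eq_one_of_injective e.injective]
    exact hf.monotone (load_pos a k)
  · rw [load_eq_one_of_injective e.injective]
    exact hf (one_lt_load_of_eq hij hne)
end

section
/- Suppose |C| > m and m does not divide |C|. Then no agreement a : C → M is simultaneously envy-free, credible, and Pareto-optimal. -/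
/-- A resource that nobody chooses has load zero. -/
theorem load_eq_zero {C M : Type*} [Fintype C] [DecidableEq M] {a : C → M} {x : M}
    (h : ∀ i, a i ≠ x) : load a x = 0 := by
  simp [load, h]

/-- If `|C| > m` and `m ∤ |C|`, then no agreement is simultaneously
envy-free, credible, and Pareto-optimal. -/
theorem no_envyFree_credible_pareto_agreement
    {C M : Type*} [Fintype C] [Fintype M] [DecidableEq M] [Nonempty C] [Nonempty M]
    (f : ℕ → ℚ)
    (hf_mono : ∀ k, f k < f (k + 1))
    (hf_conv : ∀ k, f (k + 1) - f k ≤ f (k + 2) - f (k + 1))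
    (hcard : Fintype.card M < Fintype.card C)
    (hndvd : ¬ Fintype.card M ∣ Fintype.card C) :
    ¬ ∃ a : C → M,
        (∀ i j : C, f (load a (a i)) = f (load a (a j))) ∧
        (∀ (i : C) (x : M), f (load a (a i)) ≤ f (load a x + 1)) ∧
        (¬ ∃ a' : C → M,
            (∀ i : C, f (load a' (a' i)) ≤ f (load a (a i))) ∧
            (∃ j : C, f (load a' (a' j)) < f (load a (a j)))) := by
  rintro ⟨a, henvy, hcred, -⟩
  have hf : StrictMono f := strictMono_nat_of_lt_succ hf_mono
  obtain ⟨i₀⟩ := ‹Nonempty C›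
  have hload (i : C) : load a (a i) = load a (a i₀) := hf.injective (henvy i i₀)
  by_cases hsurj : Function.Surjective a
  · refine hndvd ⟨load a (a i₀), ?_⟩
    rw [← sum_load a, Finset.sum_congr rfl fun x _ => ?_, Finset.sum_const, Finset.card_univ,
      smul_eq_mul]
    obtain ⟨i, rfl⟩ := hsurj x
    exact hload i
  · obtain ⟨x, hx⟩ : ∃ x, ∀ i, a i ≠ x := by simpa [Function.Surjective] using hsurj
    have hle (y : M) : load a y ≤ 1 := by
      by_cases hy : ∃ i, a i = y
      · obtain ⟨i, rfl⟩ := hy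
        simpa [load_eq_zero hx] using hf.le_iff_le.1 (hcred i x)
      · simp [load_eq_zero (not_exists.1 hy)]
    have hsum : ∑ y, load a y ≤ ∑ _y : M, 1 := Finset.sum_le_sum fun y _ => hle y
    rw [sum_load] at hsum
    simp only [Finset.sum_const, Finset.card_univ, smul_eq_mul, mul_one] at hsum
    exact absurd hcard hsum.not_gt
end

section
/- Let C and D be disjoint nonempty finite sets with |C| < m and |D| < m, where M is a finite set of m resources, and let a_C : C → M and a_D : D → M be injective. Then there exists a permutation ψ of M such that the combined load function n(x) = |{i ∈ C : ψ(a_C(i)) = x}| + |{j ∈ D : a_D(j) = x}| is not evenly distributed: there exist resources x, y ∈ M with n(x) ≥ n(y) + 2. -/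
theorem Equiv.Perm.exists_apply_eq_and_apply_eq {M : Type*} [DecidableEq M] {a b c d : M}
    (hab : a ≠ b) (hcd : c ≠ d) : ∃ ψ : Equiv.Perm M, ψ a = c ∧ ψ b = d := by
  have h : c ≠ Equiv.swap a c b := fun h =>
    hab ((Equiv.swap a c).injective ((Equiv.swap_apply_left a c).trans h))
  refine ⟨Equiv.swap (Equiv.swap a c b) d * Equiv.swap a c, ?_, ?_⟩
  · rw [Equiv.Perm.mul_apply, Equiv.swap_apply_left, Equiv.swap_apply_of_ne_of_ne h hcd]
  · rw [Equiv.Perm.mul_apply, Equiv.swap_apply_left]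

theorem Fintype.exists_forall_apply_ne_of_card_lt {α β : Type*} [Fintype α] [Fintype β]
    (f : α → β) (h : Fintype.card α < Fintype.card β) : ∃ b, ∀ a, f a ≠ b := by
  by_contra! hf
  exact absurd (Fintype.card_le_of_surjective f hf) h.not_ge


/-- If two disjoint coalitions `C` and `D`, each of size `< m`, choose
injective agreements independently, then some relabeling `ψ` of the resources used by `C`
produces a combined assignment that is not evenly distributed. -/
theorem two_small_coalitions_uneven_relabeling
    {C D M : Type*} [Fintype C] [Fintype D] [Fintype M] [DecidableEq M]
    [Nonempty C] [Nonempty D]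
    (hC : Fintype.card C < Fintype.card M)
    (hD : Fintype.card D < Fintype.card M)
    (aC : C → M) (aD : D → M)
    (hinjC : Function.Injective aC) (hinjD : Function.Injective aD) :
    ∃ ψ : Equiv.Perm M, ∃ x y : M,
      ((Finset.univ.filter fun i : C => ψ (aC i) = y).card +
        (Finset.univ.filter fun j : D => aD j = y).card) + 2 ≤
      ((Finset.univ.filter fun i : C => ψ (aC i) = x).card +
        (Finset.univ.filter fun j : D => aD j = x).card) := by
  obtain ⟨u, hu⟩ := Fintype.exists_forall_apply_ne_of_card_lt aC hC
  obtain ⟨v, hv⟩ := Fintype.exists_forall_apply_ne_of_card_lt aD hD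
  obtain ⟨i⟩ := ‹Nonempty C›
  obtain ⟨j⟩ := ‹Nonempty D›
  obtain ⟨ψ, hψi, hψu⟩ := Equiv.Perm.exists_apply_eq_and_apply_eq (hu i) (hv j)
  refine ⟨ψ, aD j, v, ?_⟩
  have hCv : (Finset.univ.filter fun i : C => ψ (aC i) = v) = ∅ :=
    Finset.filter_eq_empty_iff.2 fun k _ hk => hu k (ψ.injective (hk.trans hψu.symm))
  have hDv : (Finset.univ.filter fun j : D => aD j = v) = ∅ :=
    Finset.filter_eq_empty_iff.2 fun k _ => hv k
  have hCx : 0 < (Finset.univ.filter fun i : C => ψ (aC i) = aD j).card :=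
    Finset.card_pos.2 ⟨i, Finset.mem_filter.2 ⟨Finset.mem_univ _, hψi⟩⟩
  have hDx : 0 < (Finset.univ.filter fun k : D => aD k = aD j).card :=
    Finset.card_pos.2 ⟨j, Finset.mem_filter.2 ⟨Finset.mem_univ _, rfl⟩⟩
  rw [hCv, hDv, Finset.card_empty, Finset.card_empty]
  omega
end
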